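/- Define two 10×10 zero-one matrices F_0 and F_1 by their rows (rows and columns indexed 0,…,9): F_0 has rows 1000000111, 0100000111, 0010111000, 0001111000, 1100110000, 1100110000, 1100001100, 0011001100, 0011000011, 0011000011; F_1 has rows 1000111000, 0100111000, 0010000111, 0001000111, 0011110000, 0011110000, 0011001100, 1100001100, 1100000011, 1100000011. Then there is no pair (L_0, L_1) of orthogonal Latin squares of order 10 on the symbol set {0,…,9} together with subsets S_0, S_1 ⊆ {0,…,9} with |S_0| = |S_1| = 4 such that for all cells (i,j): L_0[i,j] ∈ S_0 if and only if F_0[i,j] = 1, and L_1[i,j] ∈ S_1 if and only if F_1[i,j] = 1. -/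

import Mathlib

/-- The frequency square `F₀` from the template in Figure 1. -/
def F0 : Matrix (Fin 10) (Fin 10) ℕ :=
  !![1,0,0,0,0,0,0,1,1,1;
     0,1,0,0,0,0,0,1,1,1;
     0,0,1,0,1,1,1,0,0,0;
     0,0,0,1,1,1,1,0,0,0;
     1,1,0,0,1,1,0,0,0,0;
     1,1,0,0,1,1,0,0,0,0;
     1,1,0,0,0,0,1,1,0,0;
     0,0,1,1,0,0,1,1,0,0;
     0,0,1,1,0,0,0,0,1,1;
     0,0,1,1,0,0,0,0,1,1]

/-- The frequency square `F₁` from the template in Figure 1. -/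
def F1 : Matrix (Fin 10) (Fin 10) ℕ :=
  !![1,0,0,0,1,1,1,0,0,0;
     0,1,0,0,1,1,1,0,0,0;
     0,0,1,0,0,0,0,1,1,1;
     0,0,0,1,0,0,0,1,1,1;
     0,0,1,1,1,1,0,0,0,0;
     0,0,1,1,1,1,0,0,0,0;
     0,0,1,1,0,0,1,1,0,0;
     1,1,0,0,0,0,1,1,0,0;
     1,1,0,0,0,0,0,0,1,1;
     1,1,0,0,0,0,0,0,1,1]

theorem aux_lin (x : Fin 10 → Fin 10 → ℕ) (hr : ∀ i, ∑ j, x i j = 1) (hc : ∀ j, ∑ i, x i j = 1)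
    (h0 : ∀ i j, F0 i j ≠ 1 → x i j = 0) (h1 : ∑ i, ∑ j, F1 i j * x i j = 4) :
    x 0 0 + x 1 1 ≤ 1 ∧ (x 0 0 + x 1 1 = 1 → x 6 7 = 1) := by
  have e : ∀ i j, x i j = F0 i j * x i j := by
    intro i j
    by_cases h : F0 i j = 1
    · rw [h, one_mul]
    · rw [h0 i j h, mul_zero]
  have hr' : ∀ i, ∑ j, F0 i j * x i j = 1 := fun i => by
    rw [← hr i]; exact Finset.sum_congr rfl fun j _ => (e i j).symm
  have hc' : ∀ j, ∑ i, F0 i j * x i j = 1 := fun j => by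
    rw [← hc j]; exact Finset.sum_congr rfl fun i _ => (e i j).symm
  have h1' : ∑ i, ∑ j, F1 i j * (F0 i j * x i j) = 4 := by
    rw [← h1]
    exact Finset.sum_congr rfl fun i _ => Finset.sum_congr rfl fun j _ => by rw [← e i j]
  have r0 := hr' 0
  have r1 := hr' 1
  have r2 := hr' 2
  have r3 := hr' 3
  have r4 := hr' 4
  have r5 := hr' 5
  have r6 := hr' 6
  have r7 := hr' 7
  have r8 := hr' 8
  have r9 := hr' 9
  have c0 := hc' 0
  have c1 := hc' 1
  have c2 := hc' 2
  have c3 := hc' 3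
  have c4 := hc' 4
  have c5 := hc' 5
  have c6 := hc' 6
  have c7 := hc' 7
  have c8 := hc' 8
  have c9 := hc' 9
  clear hr hc hr' hc' h0 h1 e
  simp [Fin.sum_univ_succ, F0, F1, Fin.succ] at r0 r1 r2 r3 r4 r5 r6 r7 r8 r9 c0 c1 c2 c3 c4 c5 c6 c7 c8 c9 h1'
  constructor
  · omega
  · intro h
    omega

theorem aux_sum (L0 L1 : Fin 10 → Fin 10 → Fin 10) (S1 : Finset (Fin 10))
    (ho : Function.Injective (fun p : Fin 10 × Fin 10 => (L0 p.1 p.2, L1 p.1 p.2)))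
    (hS : S1.card = 4) (hF : ∀ i j : Fin 10, (L1 i j ∈ S1 ↔ F1 i j = 1)) (s : Fin 10) :
    ∑ i, ∑ j, F1 i j * (if L0 i j = s then 1 else 0) = 4 := by
  have hb := Finite.injective_iff_bijective.mp ho
  have h01 : ∀ i j : Fin 10, F1 i j ≤ 1 := by
    intro i j
    fin_cases i <;> fin_cases j <;> simp [F1]
  have hf : ∀ i j, F1 i j = if L1 i j ∈ S1 then 1 else 0 := by
    intro i j
    have := h01 i j
    have := hF i j
    split_ifs <;> grind
  rw [← Fintype.sum_prod_type' (f := fun i j => F1 i j * (if L0 i j = s then 1 else 0))]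
  have := hb.sum_comp (fun q : Fin 10 × Fin 10 =>
    (if q.2 ∈ S1 then 1 else 0) * (if q.1 = s then 1 else 0))
  simp only [hf]
  rw [this, Fintype.sum_prod_type]
  simp [hS]

theorem aux_inj (f : Fin 10 → Fin 10) (hf : Function.Injective f) (s : Fin 10) :
    ∑ j, (if f j = s then 1 else 0) = 1 := by
  have hb := Finite.injective_iff_bijective.mp hf
  rw [hb.sum_comp (fun q => if q = s then 1 else 0)]
  simp

/-- no pair of orthogonal Latin squares of order 10 refines the
template `(F0, F1)`: there are no orthogonal Latin squares `L0, L1` on symbols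
`{0,…,9}` and 4-element symbol sets `S0, S1` such that, in every cell, the symbol
of `L0` lies in `S0` exactly where `F0` has a 1, and the symbol of `L1` lies in
`S1` exactly where `F1` has a 1. -/
theorem statement8 :
    ¬ ∃ (L0 L1 : Fin 10 → Fin 10 → Fin 10) (S0 S1 : Finset (Fin 10)),
      (∀ i, Function.Injective (L0 i)) ∧
      (∀ j, Function.Injective (fun i => L0 i j)) ∧
      (∀ i, Function.Injective (L1 i)) ∧
      (∀ j, Function.Injective (fun i => L1 i j)) ∧
      Function.Injective (fun p : Fin 10 × Fin 10 => (L0 p.1 p.2, L1 p.1 p.2)) ∧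
      S0.card = 4 ∧ S1.card = 4 ∧
      (∀ i j : Fin 10,
        (L0 i j ∈ S0 ↔ F0 i j = 1) ∧ (L1 i j ∈ S1 ↔ F1 i j = 1)) := by
  rintro ⟨L0, L1, S0, S1, hr, hc, -, -, ho, -, hS, hF⟩
  have key : ∀ s ∈ S0, _ := fun s hs =>
    aux_lin (fun i j => if L0 i j = s then 1 else 0) (fun i => aux_inj _ (hr i) s)
      (fun j => aux_inj _ (hc j) s)
      (fun i j h => if_neg fun (h' : L0 i j = s) => h ((hF i j).1.mp (by rw [h']; exact hs)))
      (aux_sum L0 L1 S1 ho hS (fun i j => (hF i j).2) s)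
  have k0 := key (L0 0 0) ((hF 0 0).1.mpr (by decide))
  have k1 := key (L0 1 1) ((hF 1 1).1.mpr (by decide))
  simp only [if_true] at k0 k1
  by_cases h : L0 0 0 = L0 1 1
  · simp [h] at k0
  · have h' : L0 1 1 ≠ L0 0 0 := fun e => h e.symm
    simp [h, h'] at k0 k1
    exact h (k0.symm.trans k1)
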